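/- No minimally imperfect graph contains a 6-join. -/

import Mathlib

open SimpleGraph

/-- A graph is perfect if, in every induced subgraph, the clique number equals
the chromatic number. -/
def IsPerfect {V : Type*} (G : SimpleGraph V) : Prop :=
  ∀ S : Set V, ((G.induce S).cliqueNum : ℕ∞) = (G.induce S).chromaticNumber

/-- A graph is minimally imperfect if it is not perfect but every proper induced
subgraph of it is perfect. -/
def MinimallyImperfect {V : Type*} (G : SimpleGraph V) : Prop :=
  ¬ IsPerfect G ∧ ∀ S : Set V, S ≠ Set.univ → IsPerfect (G.induce S)

/-- A graph has a 6-join: the vertex set is partitioned into eight nonempty sets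
`X1, X2, X3, X4, Y1, Y2, Y3, Y4` such that for all `xi ∈ Xi` (`i = 1,2,3`) and
`yj ∈ Yj` (`j = 1,2,3`) the six vertices induce a 6-hole with edges
`x1y1, y1x2, x2y2, y2x3, x3y3, y3x1`, and these kinds of edges are the only
adjacencies between `X = X1 ∪ X2 ∪ X3 ∪ X4` and `Y = Y1 ∪ Y2 ∪ Y3 ∪ Y4`. -/
def HasSixJoin {V : Type*} (G : SimpleGraph V) : Prop :=
  ∃ X1 X2 X3 X4 Y1 Y2 Y3 Y4 : Set V,
    X1.Nonempty ∧ X2.Nonempty ∧ X3.Nonempty ∧ X4.Nonempty ∧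
    Y1.Nonempty ∧ Y2.Nonempty ∧ Y3.Nonempty ∧ Y4.Nonempty ∧
    (X1 ∪ X2 ∪ X3 ∪ X4) ∪ (Y1 ∪ Y2 ∪ Y3 ∪ Y4) = Set.univ ∧
    ([X1, X2, X3, X4, Y1, Y2, Y3, Y4] : List (Set V)).Pairwise Disjoint ∧
    (∀ x1 ∈ X1, ∀ x2 ∈ X2, ∀ x3 ∈ X3, ∀ y1 ∈ Y1, ∀ y2 ∈ Y2, ∀ y3 ∈ Y3,
      G.Adj x1 y1 ∧ G.Adj y1 x2 ∧ G.Adj x2 y2 ∧ G.Adj y2 x3 ∧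
      G.Adj x3 y3 ∧ G.Adj y3 x1 ∧
      ¬ G.Adj x1 x2 ∧ ¬ G.Adj x2 x3 ∧ ¬ G.Adj x1 x3 ∧
      ¬ G.Adj y1 y2 ∧ ¬ G.Adj y2 y3 ∧ ¬ G.Adj y1 y3 ∧
      ¬ G.Adj x1 y2 ∧ ¬ G.Adj x2 y3 ∧ ¬ G.Adj x3 y1) ∧
    (∀ x ∈ X1 ∪ X2 ∪ X3 ∪ X4, ∀ y ∈ Y1 ∪ Y2 ∪ Y3 ∪ Y4, G.Adj x y →
      (x ∈ X1 ∧ y ∈ Y1) ∨ (x ∈ X2 ∧ y ∈ Y1) ∨ (x ∈ X2 ∧ y ∈ Y2) ∨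
      (x ∈ X3 ∧ y ∈ Y2) ∨ (x ∈ X3 ∧ y ∈ Y3) ∨ (x ∈ X1 ∧ y ∈ Y3))

/-- The combinatorial heart of the argument: two families of colour classes of complementary sides
contain a compatible pair. -/
lemma exists_compatible_pair {n : ℕ} {a b : Fin 3 → ℕ} (ha : ∀ i, 0 < a i) (hb : ∀ i, 0 < b i)
    (hab : ∀ i j, i ≠ j → a i + b j ≤ n)
    {T T' : Fin n → Finset (Fin 3)} {P P' Q Q' : Fin n → Fin 3 → Prop}
    (hQP : ∀ c i, Q c i → P c i) (hQP' : ∀ c i, Q' c i → P' c i)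
    (hPT : ∀ c i, P c i → T c ⊆ {i}) (hPT' : ∀ c i, P' c i → T' c ⊆ {i})
    (ht : ∀ i j, i ≠ j → a i + b j = n → ∀ c, j ∈ T c ∨ Q c i)
    (ht' : ∀ i j, i ≠ j → a i + b j = n → ∀ d, i ∈ T' d ∨ Q' d j)
    (hT : ∀ j, (Finset.univ.filter fun c => j ∈ T c).card = b j)
    (hT' : ∀ i, (Finset.univ.filter fun d => i ∈ T' d).card = a i) :
    ∃ c d, (∀ i j, i ≠ j → ¬ (P c i ∧ P' d j)) ∧
      ∀ i j, i ≠ j → a i + b j = n → Q c i ∨ Q' d j := by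
  by_contra H
  push Not at H
  have glue : ∀ c d, (∀ i j, i ≠ j → ¬ (P c i ∧ P' d j)) →
      (∀ i j, i ≠ j → a i + b j = n → Q c i ∨ Q' d j) → False := by
    intro c d h1 h2
    obtain ⟨i, j, hij, ht, h3, h4⟩ := H c d (fun i j hij hP hP' => h1 i j hij ⟨hP, hP'⟩)
    exact (h2 i j hij ht).elim h3 h4
  have exT : ∀ j, ∃ c, j ∈ T c := fun j => by
    obtain ⟨c, hc⟩ := Finset.card_pos.1 ((hT j).symm ▸ hb j)
    exact ⟨c, (Finset.mem_filter.1 hc).2⟩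
  have exT' : ∀ i, ∃ d, i ∈ T' d := fun i => by
    obtain ⟨d, hd⟩ := Finset.card_pos.1 ((hT' i).symm ▸ ha i)
    exact ⟨d, (Finset.mem_filter.1 hd).2⟩
  have nP : ∀ c, 2 ≤ (T c).card → ∀ i, ¬ P c i := fun c hc i hP => by
    have := Finset.card_le_card (hPT c i hP)
    simp at this
    omega
  have nP' : ∀ c, 2 ≤ (T' c).card → ∀ i, ¬ P' c i := fun c hc i hP => by
    have := Finset.card_le_card (hPT' c i hP)
    simp at this
    omega
  have single : ∀ (s : Finset (Fin 3)) k, k ∈ s → s.card < 2 → s = {k} := fun s k hk hs =>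
    (Finset.eq_of_subset_of_card_le (Finset.singleton_subset_iff.2 hk)
      (by simp; omega)).symm
  have third : ∀ i j : Fin 3, ∃ k, k ≠ i ∧ k ≠ j := by decide
  have empty_left : ∀ c d, T c = ∅ → 2 ≤ (T' d).card → False := fun c d hc hd =>
    glue c d (fun i j _ h => nP' d hd j h.2) fun i j hij hh =>
      Or.inl ((ht i j hij hh c).resolve_left (by simp [hc]))
  have empty_right : ∀ c d, T' d = ∅ → 2 ≤ (T c).card → False := fun c d hd hc =>
    glue c d (fun i j _ h => nP c hc i h.1) fun i j hij hh =>
      Or.inr ((ht' i j hij hh d).resolve_left (by simp [hd]))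
  have tight_of_left : ∀ c, 2 ≤ (T c).card → ∃ i j, i ≠ j ∧ a i + b j = n := fun c hc => by
    by_contra h
    push Not at h
    exact glue c c (fun i j _ h => nP c hc i h.1) fun i j hij hh => absurd hh (h i j hij)
  have tight_of_right : ∀ d, 2 ≤ (T' d).card → ∃ i j, i ≠ j ∧ a i + b j = n := fun d hd => by
    by_contra h
    push Not at h
    exact glue d d (fun i j _ h => nP' d hd j h.2) fun i j hij hh => absurd hh (h i j hij)
  by_cases hc : ∃ c, 2 ≤ (T c).card <;> by_cases hd : ∃ d, 2 ≤ (T' d).card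
  · obtain ⟨c, hc⟩ := hc
    obtain ⟨d, hd⟩ := hd
    obtain ⟨i, j, hij, hh⟩ := tight_of_left c hc
    have ne : ∀ c, T c ≠ ∅ := fun c h => empty_left c d h hd
    have ne' : ∀ d, T' d ≠ ∅ := fun d h => empty_right c d h hc
    have eqT : ∀ i j, i ≠ j → a i + b j = n → ∀ c, j ∉ T c → T c = {i} :=
      fun i j hij hh c hj => (Finset.subset_singleton_iff.1
        (hPT c i (hQP c i ((ht i j hij hh c).resolve_left hj)))).resolve_left (ne c)
    have eqT' : ∀ d, i ∉ T' d → T' d = {j} :=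
      fun d hi => (Finset.subset_singleton_iff.1
        (hPT' d j (hQP' d j ((ht' i j hij hh d).resolve_left hi)))).resolve_left (ne' d)
    have cardT := Finset.card_filter_add_card_filter_not (s := (Finset.univ : Finset (Fin n)))
      (fun c => j ∈ T c)
    have cardT' := Finset.card_filter_add_card_filter_not (s := (Finset.univ : Finset (Fin n)))
      (fun d => i ∈ T' d)
    rw [hT, Finset.card_univ, Fintype.card_fin] at cardT
    rw [hT', Finset.card_univ, Fintype.card_fin] at cardT'
    have sub : (Finset.univ.filter fun c => j ∉ T c) ⊆ Finset.univ.filter fun c => i ∈ T c := by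
      intro e he
      simp only [Finset.mem_filter, Finset.mem_univ, true_and] at he ⊢
      simp [eqT i j hij hh e he]
    have sub' : (Finset.univ.filter fun d => i ∉ T' d) ⊆
        Finset.univ.filter fun d => j ∈ T' d := by
      intro e he
      simp only [Finset.mem_filter, Finset.mem_univ, true_and] at he ⊢
      simp [eqT' e he]
    have le := Finset.card_le_card sub
    have le' := Finset.card_le_card sub'
    rw [hT] at le
    rw [hT'] at le'
    have hji := hab j i hij.symm
    have hh' : a j + b i = n := by omega
    have eq := Finset.eq_of_subset_of_card_le sub (by rw [hT]; omega)
    have sing : ∀ k, T c = {k} → False := fun k h => by simp [h] at hc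
    by_cases hi : i ∈ T c
    · have : c ∈ Finset.univ.filter fun c => j ∉ T c := by rw [eq]; simpa using hi
      exact sing i (eqT i j hij hh c (by simpa using this))
    · exact sing j (eqT j i hij.symm hh' c hi)
  · obtain ⟨c, hc⟩ := hc
    obtain ⟨i, j, hij, hh⟩ := tight_of_left c hc
    obtain ⟨k, hki, hkj⟩ := third i j
    obtain ⟨d, hk⟩ := exT' k
    push Not at hd
    have hs := single _ _ hk (hd d)
    have := hPT' d j (hQP' d j ((ht' i j hij hh d).resolve_left (by simpa [hs] using hki.symm)))
    simp [hs, hkj] at this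
  · obtain ⟨d, hd⟩ := hd
    obtain ⟨i, j, hij, hh⟩ := tight_of_right d hd
    obtain ⟨k, hki, hkj⟩ := third i j
    obtain ⟨c, hk⟩ := exT k
    push Not at hc
    have hs := single _ _ hk (hc c)
    have := hPT c i (hQP c i ((ht i j hij hh c).resolve_left (by simpa [hs] using hkj.symm)))
    simp [hs, hki] at this
  · push Not at hc hd
    obtain ⟨c, h0⟩ := exT 0
    obtain ⟨d, h0'⟩ := exT' 0
    have hs := single _ _ h0 (hc c)
    have hs' := single _ _ h0' (hd d)
    refine glue c d (fun i j hij h => ?_) fun i j hij hh => ?_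
    · have h1 := hPT c i h.1
      have h2 := hPT' d j h.2
      simp [hs] at h1
      simp [hs'] at h2
      exact hij (h1.symm.trans h2)
    · by_cases hj : j = 0
      · exact Or.inr ((ht' i j hij hh d).resolve_left (by simpa [hs'] using hj ▸ hij))
      · exact Or.inl ((ht i j hij hh c).resolve_left (by simpa [hs] using hj))

section

variable {V : Type*} {G : SimpleGraph V}

/-- A colouring of an induced subgraph as a family of stable sets. -/
lemma exists_colorClasses {S : Set V} {n : ℕ} (h : (G.induce S).Colorable n) :
    ∃ D : Fin n → Set V, (∀ c, ∀ u ∈ D c, ∀ v ∈ D c, ¬ G.Adj u v) ∧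
      (∀ v ∈ S, ∃ c, v ∈ D c) ∧ (∀ c d v, v ∈ D c → v ∈ D d → c = d) := by
  obtain ⟨f⟩ := h
  refine ⟨fun c => {v | ∃ hv : v ∈ S, f ⟨v, hv⟩ = c}, ?_, fun v hv => ⟨_, hv, rfl⟩, ?_⟩
  · rintro c u ⟨hu, rfl⟩ v ⟨hv, hc⟩ huv
    exact f.valid (v := ⟨u, hu⟩) (w := ⟨v, hv⟩) huv hc.symm
  · rintro c d v ⟨hv, rfl⟩ ⟨_, rfl⟩
    rfl

/-- In a partition into `n` stable sets, every part meets every clique of size `n`. -/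
lemma exists_mem_colorClass {n : ℕ} {S : Set V} {D : Fin n → Set V}
    (hD : ∀ c, ∀ u ∈ D c, ∀ v ∈ D c, ¬ G.Adj u v) (hS : ∀ v ∈ S, ∃ c, v ∈ D c)
    {K : Finset V} (hK : G.IsClique K) (hKS : (K : Set V) ⊆ S) (hn : K.card = n) (c : Fin n) :
    ∃ v ∈ K, v ∈ D c := by
  choose f hf using fun v : K => hS v (hKS v.2)
  have inj : Function.Injective f := by
    intro u v huv
    by_contra hne
    exact hD (f u) u (hf u) v (huv ▸ hf v)
      (hK u.2 v.2 fun h => hne (Subtype.ext h))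
  have bij := (Fintype.bijective_iff_injective_and_card f).2 ⟨inj, by simp [hn]⟩
  obtain ⟨v, rfl⟩ := bij.2 c
  exact ⟨v, v.2, hf v⟩

/-- Every set of vertices of a finite graph contains a largest clique. -/
lemma exists_max_clique [Finite V] (G : SimpleGraph V) (S : Set V) :
    ∃ K : Finset V, G.IsClique K ∧ (K : Set V) ⊆ S ∧
      ∀ L : Finset V, G.IsClique L → (L : Set V) ⊆ S → L.card ≤ K.card := by
  obtain ⟨K, hK, hmax⟩ := Set.exists_max_image {K : Finset V | G.IsClique K ∧ (K : Set V) ⊆ S}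
    Finset.card (Set.toFinite _) ⟨∅, by simp⟩
  exact ⟨K, hK.1, hK.2, fun L h1 h2 => hmax L ⟨h1, h2⟩⟩

/-- The family of colour classes on one side `A` of a 6-join, obtained by colouring `A` together
with largest cliques `L j` in the attachment sets of the other side. -/
lemma exists_side_coloring {n : ℕ} {A : Set V} {X : Fin 3 → Set V}
    {L : Fin 3 → Finset V} {a : Fin 3 → ℕ} (hXA : ∀ i, X i ⊆ A)
    (hL : ∀ j, G.IsClique (L j)) (hXL : ∀ i j, i ≠ j → ∀ x ∈ X i, ∀ y ∈ L j, G.Adj x y)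
    (hcol : (G.induce (A ∪ ⋃ j, (L j : Set V))).Colorable n) :
    ∃ (C : Fin n → Set V) (T : Fin n → Finset (Fin 3)),
      (∀ c, C c ⊆ A) ∧ (∀ c, ∀ u ∈ C c, ∀ v ∈ C c, ¬ G.Adj u v) ∧
      (∀ c, ∀ K : Finset V, G.IsClique K → (K : Set V) ⊆ A → K.card = n → ∃ v ∈ K, v ∈ C c) ∧
      (∀ c i, (C c ∩ X i).Nonempty → T c ⊆ {i}) ∧
      (∀ i j, i ≠ j → a i + (L j).card = n → ∀ c, j ∈ T c ∨
        ∀ K : Finset V, G.IsClique K → (K : Set V) ⊆ X i → K.card = a i → ∃ v ∈ K, v ∈ C c) ∧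
      ∀ j, (Finset.univ.filter fun c => j ∈ T c).card = (L j).card := by
  classical
  obtain ⟨D, hD, hcov, huniq⟩ := exists_colorClasses hcol
  have hLS : ∀ j, (L j : Set V) ⊆ A ∪ ⋃ j, (L j : Set V) := fun j =>
    (Set.subset_iUnion (fun j => (L j : Set V)) j).trans Set.subset_union_right
  refine ⟨fun c => D c ∩ A, fun c => Finset.univ.filter fun j => ∃ v ∈ L j, v ∈ D c,
    fun c => Set.inter_subset_right, fun c u hu v hv => hD c u hu.1 v hv.1, ?_, ?_, ?_, ?_⟩
  · intro c K hK hKA hn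
    obtain ⟨v, hv, hvc⟩ := exists_mem_colorClass hD hcov hK
      (hKA.trans Set.subset_union_left) hn c
    exact ⟨v, hv, hvc, hKA hv⟩
  · rintro c i ⟨x, ⟨hxc, -⟩, hxi⟩ j hj
    obtain ⟨y, hy, hyc⟩ := (Finset.mem_filter.1 hj).2
    by_contra hne
    exact hD c x hxc y hyc (hXL i j (fun h => hne (by simp [h])) x hxi y hy)
  · intro i j hij hn c
    by_cases hj : ∃ v ∈ L j, v ∈ D c
    · exact Or.inl (by simpa using hj)
    refine Or.inr fun K hK hKi hKa => ?_
    have hdisj : Disjoint K (L j) := Finset.disjoint_left.2 fun v h1 h2 =>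
      G.irrefl (hXL i j hij v (hKi h1) v h2)
    have hKL : G.IsClique (K ∪ L j : Finset V) := by
      intro u hu v hv huv
      simp only [Finset.coe_union, Set.mem_union, Finset.mem_coe] at hu hv
      rcases hu with hu | hu <;> rcases hv with hv | hv
      · exact hK hu hv huv
      · exact hXL i j hij u (hKi hu) v hv
      · exact (hXL i j hij v (hKi hv) u hu).symm
      · exact hL j hu hv huv
    obtain ⟨v, hv, hvc⟩ := exists_mem_colorClass hD hcov hKL
      (by
        rw [Finset.coe_union]
        exact Set.union_subset ((hKi.trans (hXA i)).trans Set.subset_union_left) (hLS j))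
      (by rw [Finset.card_union_of_disjoint hdisj, hKa, hn]) c
    rcases Finset.mem_union.1 hv with hv | hv
    · exact ⟨v, hv, hvc, hXA i (hKi hv)⟩
    · exact absurd ⟨v, hv, hvc⟩ hj
  · intro j
    choose f hf using fun v : L j => hcov v (hLS j v.2)
    have inj : Function.Injective f := by
      intro u v huv
      by_contra hne
      exact hD (f u) u (hf u) v (huv ▸ hf v)
        (hL j u.2 v.2 fun h => hne (Subtype.ext h))
    rw [← Fintype.card_coe (L j), ← Finset.card_univ, ← Finset.card_image_of_injective _ inj]
    congr 1
    ext c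
    simp only [Finset.mem_filter, Finset.mem_univ, true_and, Finset.mem_image]
    constructor
    · rintro ⟨v, hv, hvc⟩
      exact ⟨⟨v, hv⟩, huniq _ _ v (hf ⟨v, hv⟩) hvc⟩
    · rintro ⟨v, rfl⟩
      exact ⟨v, v.2, hf v⟩

/-- Proper induced subgraphs of a minimally imperfect graph can be coloured with as many colours
as the size of a largest clique. -/
lemma MinimallyImperfect.colorable_induce [Finite V] (hmi : MinimallyImperfect G) {S : Set V}
    (hS : S ≠ Set.univ) {m : ℕ}
    (hm : ∀ K : Finset V, G.IsClique K → (K : Set V) ⊆ S → K.card ≤ m) :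
    (G.induce S).Colorable m := by
  have h := hmi.2 S hS Set.univ
  have e : (G.induce S).induce Set.univ ≃g G.induce S := SimpleGraph.induceUnivIso _
  obtain ⟨K, hK⟩ := ((G.induce S).induce Set.univ).exists_isNClique_cliqueNum
  have hle : ((G.induce S).induce Set.univ).cliqueNum ≤ m := by
    rw [← hK.card_eq, ← Finset.card_map
      ((Function.Embedding.subtype _).trans (Function.Embedding.subtype _))]
    apply hm
    · intro u hu v hv huv
      simp only [Finset.coe_map, Set.mem_image, Finset.mem_coe] at hu hv
      obtain ⟨u, hu, rfl⟩ := hu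
      obtain ⟨v, hv, rfl⟩ := hv
      exact hK.isClique hu hv fun h => huv (by rw [h])
    · intro u hu
      simp only [Finset.coe_map, Set.mem_image, Finset.mem_coe] at hu
      obtain ⟨u, -, rfl⟩ := hu
      exact u.1.2
  have hcol : ((G.induce S).induce Set.univ).Colorable m :=
    SimpleGraph.chromaticNumber_le_iff_colorable.1 (h ▸ by exact_mod_cast hle)
  exact hcol.of_hom e.symm.toHom

/-- A minimally imperfect graph cannot be coloured with `G.cliqueNum` colours. -/
lemma MinimallyImperfect.not_colorable [Finite V] (hmi : MinimallyImperfect G) :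
    ¬ G.Colorable G.cliqueNum := by
  intro hcol
  refine hmi.1 fun S => ?_
  obtain ⟨K, hK, hKS, hmax⟩ := exists_max_clique G S
  have hle : K.card ≤ (G.induce S).cliqueNum := by
    classical
    have hc : (G.induce S).IsClique (K.subtype (· ∈ S) : Finset S) := by
      intro u hu v hv huv
      simp only [Finset.mem_coe, Finset.mem_subtype] at hu hv
      exact hK hu hv fun h => huv (Subtype.ext h)
    have := hc.card_le_cliqueNum
    rwa [Finset.card_subtype, Finset.filter_true_of_mem fun v hv => hKS hv] at this
  have hge : ((G.induce S).cliqueNum : ℕ∞) ≤ (G.induce S).chromaticNumber :=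
    (G.induce S).cliqueNum_le_chromaticNumber
  refine le_antisymm hge ?_
  refine SimpleGraph.chromaticNumber_le_iff_colorable.2 ?_
  by_cases hS : S = Set.univ
  · subst hS
    have e : G.induce Set.univ ≃g G := SimpleGraph.induceUnivIso _
    refine (hcol.of_hom e.toHom).mono ?_
    obtain ⟨L, hL⟩ := G.exists_isNClique_cliqueNum
    rw [← hL.card_eq]
    exact (hmax L hL.isClique (Set.subset_univ _)).trans hle
  · exact (hmi.colorable_induce hS hmax).mono hle

/-- No stable set of a minimally imperfect graph meets all its largest cliques. -/
lemma MinimallyImperfect.exists_clique_avoiding [Finite V] (hmi : MinimallyImperfect G) {S : Set V}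
    (hS : ∀ u ∈ S, ∀ v ∈ S, ¬ G.Adj u v) :
    ∃ K : Finset V, G.IsClique K ∧ K.card = G.cliqueNum ∧ ∀ v ∈ K, v ∉ S := by
  by_contra! h
  obtain ⟨L, hL⟩ := G.exists_isNClique_cliqueNum
  obtain ⟨s, hsL, hs⟩ := h L hL.isClique hL.card_eq
  obtain ⟨m, hm⟩ : ∃ m, G.cliqueNum = m + 1 :=
    Nat.exists_eq_succ_of_ne_zero (hL.card_eq ▸ (Finset.card_pos.2 ⟨s, hsL⟩).ne')
  have hcol : (G.induce Sᶜ).Colorable m := by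
    refine hmi.colorable_induce (fun h => ?_) fun K hK hKS => ?_
    · exact (h.symm ▸ Set.mem_univ s : s ∈ Sᶜ) hs
    · have hle := hK.card_le_cliqueNum
      by_contra hlt
      obtain ⟨v, hv, hvS⟩ := h K hK (by omega)
      exact hKS hv hvS
  apply hmi.not_colorable
  rw [hm]
  classical
  obtain ⟨f⟩ := hcol
  refine ⟨SimpleGraph.Coloring.mk
    (fun v => if h : v ∈ S then Fin.last m else (f ⟨v, h⟩).castSucc) ?_⟩
  intro u v huv
  by_cases hu : u ∈ S <;> by_cases hv : v ∈ S
  · exact absurd huv (hS u hu v hv)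
  · simpa [hu, hv] using (Fin.castSucc_lt_last _).ne'
  · simp [hu, hv]
  · simpa [hu, hv] using f.valid (v := ⟨u, hu⟩) (w := ⟨v, hv⟩) huv

/-- The symmetric form of the main theorem: `X i` is complete to `Z j` exactly when `i ≠ j`. -/
lemma MinimallyImperfect.false_of_sixJoin [Finite V] (hmi : MinimallyImperfect G) {A B : Set V}
    {X Z : Fin 3 → Set V} (hXA : ∀ i, X i ⊆ A) (hZB : ∀ i, Z i ⊆ B)
    (hcov : ∀ v, v ∈ A ∨ v ∈ B) (hAB : Disjoint A B)
    (hX : ∀ i, (X i).Nonempty) (hZ : ∀ i, (Z i).Nonempty)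
    (hA : ∃ v ∈ A, ∀ i, v ∉ X i) (hB : ∃ v ∈ B, ∀ i, v ∉ Z i)
    (hXX : ∀ i j, i ≠ j → ∀ x ∈ X i, ∀ y ∈ X j, x ≠ y ∧ ¬ G.Adj x y)
    (hZZ : ∀ i j, i ≠ j → ∀ x ∈ Z i, ∀ y ∈ Z j, x ≠ y ∧ ¬ G.Adj x y)
    (hXZ : ∀ i j, i ≠ j → ∀ x ∈ X i, ∀ z ∈ Z j, G.Adj x z)
    (hadj : ∀ x ∈ A, ∀ z ∈ B, G.Adj x z → ∃ i j, i ≠ j ∧ x ∈ X i ∧ z ∈ Z j) : False := by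
  classical
  choose K hK hKX hKmax using fun i => exists_max_clique G (X i)
  choose L hL hLZ hLmax using fun i => exists_max_clique G (Z i)
  have hmaxpos : ∀ {S : Set V} {M : Finset V}, S.Nonempty →
      (∀ L : Finset V, G.IsClique L → (L : Set V) ⊆ S → L.card ≤ M.card) → 0 < M.card := by
    rintro S M ⟨v, hv⟩ h
    exact h {v} (by simp) (by simpa using hv)
  have ha : ∀ i, 0 < (K i).card := fun i => hmaxpos (hX i) (hKmax i)
  have hb : ∀ i, 0 < (L i).card := fun i => hmaxpos (hZ i) (hLmax i)
  have hab : ∀ i j, i ≠ j → (K i).card + (L j).card ≤ G.cliqueNum := by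
    intro i j hij
    have hdisj : Disjoint (K i) (L j) := Finset.disjoint_left.2 fun v h1 h2 =>
      G.irrefl (hXZ i j hij v (hKX i h1) v (hLZ j h2))
    rw [← Finset.card_union_of_disjoint hdisj]
    apply SimpleGraph.IsClique.card_le_cliqueNum
    intro u hu v hv huv
    simp only [Finset.coe_union, Set.mem_union, Finset.mem_coe] at hu hv
    rcases hu with hu | hu <;> rcases hv with hv | hv
    · exact hK i hu hv huv
    · exact hXZ i j hij u (hKX i hu) v (hLZ j hv)
    · exact (hXZ i j hij v (hKX i hv) u (hLZ j hu)).symm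
    · exact hL j hu hv huv
  have hcolA : (G.induce (A ∪ ⋃ j, (L j : Set V))).Colorable G.cliqueNum := by
    refine hmi.colorable_induce (fun h => ?_) fun M hM _ => hM.card_le_cliqueNum
    obtain ⟨v, hv, hvZ⟩ := hB
    rcases (h.symm ▸ Set.mem_univ v : v ∈ A ∪ ⋃ j, (L j : Set V)) with h1 | h1
    · exact Set.disjoint_left.1 hAB h1 hv
    · obtain ⟨j, hj⟩ := Set.mem_iUnion.1 h1
      exact hvZ j (hLZ j hj)
  have hcolB : (G.induce (B ∪ ⋃ j, (K j : Set V))).Colorable G.cliqueNum := by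
    refine hmi.colorable_induce (fun h => ?_) fun M hM _ => hM.card_le_cliqueNum
    obtain ⟨v, hv, hvX⟩ := hA
    rcases (h.symm ▸ Set.mem_univ v : v ∈ B ∪ ⋃ j, (K j : Set V)) with h1 | h1
    · exact Set.disjoint_left.1 hAB hv h1
    · obtain ⟨j, hj⟩ := Set.mem_iUnion.1 h1
      exact hvX j (hKX j hj)
  obtain ⟨C, T, hCA, hCs, hCcl, hCT, hCt, hTcard⟩ := exists_side_coloring
    (a := fun i => (K i).card) hXA hL (fun i j hij x hx y hy => hXZ i j hij x hx y (hLZ j hy)) hcolA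
  obtain ⟨D, T', hDB, hDs, hDcl, hDT, hDt, hTcard'⟩ := exists_side_coloring
    (a := fun i => (L i).card) hZB hK
    (fun i j hij z hz x hx => (hXZ j i hij.symm x (hKX j hx) z hz).symm) hcolB
  obtain ⟨c, d, hst, hcl⟩ := exists_compatible_pair ha hb hab
    (P := fun c i => (C c ∩ X i).Nonempty) (P' := fun d j => (D d ∩ Z j).Nonempty)
    (fun c i h => by
      obtain ⟨v, hv, hvc⟩ := h (K i) (hK i) (hKX i) rfl
      exact ⟨v, hvc, hKX i hv⟩)
    (fun c i h => by
      obtain ⟨v, hv, hvc⟩ := h (L i) (hL i) (hLZ i) rfl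
      exact ⟨v, hvc, hLZ i hv⟩)
    hCT hDT hCt (fun i j hij h => hDt j i hij.symm (by rw [← h, add_comm])) hTcard hTcard'
  have hcross : ∀ u ∈ C c, ∀ v ∈ D d, ¬ G.Adj u v := by
    intro u hu v hv huv
    obtain ⟨i, j, hij, hui, hvj⟩ := hadj u (hCA c hu) v (hDB d hv) huv
    exact hst i j hij ⟨⟨u, hu, hui⟩, ⟨v, hv, hvj⟩⟩
  obtain ⟨M, hM, hMn, hMav⟩ := hmi.exists_clique_avoiding (S := C c ∪ D d) (by
    rintro u (hu | hu) v (hv | hv) huv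
    · exact hCs c u hu v hv huv
    · exact hcross u hu v hv huv
    · exact hcross v hv u hu huv.symm
    · exact hDs d u hu v hv huv)
  by_cases hMA : (M : Set V) ⊆ A
  · obtain ⟨v, hv, hvC⟩ := hCcl c M hM hMA hMn
    exact hMav v hv (Or.inl hvC)
  by_cases hMB : (M : Set V) ⊆ B
  · obtain ⟨v, hv, hvD⟩ := hDcl d M hM hMB hMn
    exact hMav v hv (Or.inr hvD)
  obtain ⟨z, hzM, hzA⟩ := Set.not_subset.1 hMA
  obtain ⟨x, hxM, hxB⟩ := Set.not_subset.1 hMB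
  have hzB := (hcov z).resolve_left hzA
  have hxA := (hcov x).resolve_right hxB
  obtain ⟨i, j, hij, hxi, hzj⟩ := hadj x hxA z hzB
    (hM hxM hzM fun h => hzA (h ▸ hxA))
  have hMX : ∀ u ∈ M, u ∈ A → u ∈ X i := by
    intro u hu huA
    obtain ⟨k, l, -, huk, -⟩ := hadj u huA z hzB (hM hu hzM fun h => hzA (h ▸ huA))
    by_cases hki : k = i
    · exact hki ▸ huk
    · have := hXX k i hki u huk x hxi
      exact absurd (hM hu hxM this.1) this.2
  have hMZ : ∀ u ∈ M, u ∉ A → u ∈ Z j := by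
    intro u hu huA
    have huB := (hcov u).resolve_left huA
    obtain ⟨k, l, -, -, hul⟩ := hadj x hxA u huB (hM hxM hu fun h => huA (h ▸ hxA))
    by_cases hlj : l = j
    · exact hlj ▸ hul
    · have := hZZ l j hlj u hul z hzj
      exact absurd (hM hu hzM this.1) this.2
  have h1 : G.IsClique (M.filter (· ∈ A) : Finset V) :=
    hM.subset (Finset.coe_subset.2 (Finset.filter_subset _ _))
  have h2 : G.IsClique (M.filter (· ∉ A) : Finset V) :=
    hM.subset (Finset.coe_subset.2 (Finset.filter_subset _ _))
  have h1X : ((M.filter (· ∈ A) : Finset V) : Set V) ⊆ X i := fun u hu =>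
    hMX u (Finset.mem_filter.1 hu).1 (Finset.mem_filter.1 hu).2
  have h2Z : ((M.filter (· ∉ A) : Finset V) : Set V) ⊆ Z j := fun u hu =>
    hMZ u (Finset.mem_filter.1 hu).1 (Finset.mem_filter.1 hu).2
  have hle1 := hKmax i _ h1 h1X
  have hle2 := hLmax j _ h2 h2Z
  have hsum := Finset.card_filter_add_card_filter_not (s := M) (· ∈ A)
  have hle := hab i j hij
  rcases hcl i j hij (by omega) with h | h
  · obtain ⟨v, hv, hvC⟩ := h _ h1 h1X (by omega)
    exact hMav v (Finset.mem_filter.1 hv).1 (Or.inl hvC)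
  · obtain ⟨v, hv, hvD⟩ := h _ h2 h2Z (by omega)
    exact hMav v (Finset.mem_filter.1 hv).1 (Or.inr hvD)

end

/-- No minimally imperfect graph contains a 6-join. -/
theorem minimallyImperfect_no_sixJoin {V : Type*} [Fintype V] (G : SimpleGraph V)
    (hmi : MinimallyImperfect G) :
    ¬ HasSixJoin G := by
  rintro ⟨X1, X2, X3, X4, Y1, Y2, Y3, Y4, ⟨x1, hx1⟩, ⟨x2, hx2⟩, ⟨x3, hx3⟩, ⟨x4, hx4⟩,
    ⟨y1, hy1⟩, ⟨y2, hy2⟩, ⟨y3, hy3⟩, ⟨y4, hy4⟩, hcov, hdisj, hhole, hadj⟩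
  simp only [List.pairwise_cons, List.mem_cons, List.not_mem_nil, or_false, forall_eq_or_imp,
    forall_eq, Set.disjoint_left] at hdisj
  have hc : ∀ v, v ∈ X1 ∪ X2 ∪ X3 ∪ X4 ∨ v ∈ Y1 ∪ Y2 ∪ Y3 ∪ Y4 := fun v =>
    (hcov.symm ▸ Set.mem_univ v : v ∈ (X1 ∪ X2 ∪ X3 ∪ X4) ∪ (Y1 ∪ Y2 ∪ Y3 ∪ Y4))
  refine hmi.false_of_sixJoin (X := ![X1, X2, X3]) (Z := ![Y2, Y3, Y1])
    (A := X1 ∪ X2 ∪ X3 ∪ X4) (B := Y1 ∪ Y2 ∪ Y3 ∪ Y4) ?_ ?_ hc ?_ ?_ ?_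
    ⟨x4, by simp [hx4], ?_⟩ ⟨y4, by simp [hy4], ?_⟩ ?_ ?_ ?_ ?_
  · intro i v hv
    fin_cases i <;> simp at hv <;> simp [hv]
  · intro i v hv
    fin_cases i <;> simp at hv <;> simp [hv]
  · rw [Set.disjoint_left]
    simp only [Set.mem_union]
    clear hc hcov hhole hadj
    grind
  · intro i
    fin_cases i
    exacts [⟨_, hx1⟩, ⟨_, hx2⟩, ⟨_, hx3⟩]
  · intro i
    fin_cases i
    exacts [⟨_, hy2⟩, ⟨_, hy3⟩, ⟨_, hy1⟩]
  · intro i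
    clear hc hcov hhole hadj
    fin_cases i <;> simp <;> grind
  · intro i
    clear hc hcov hhole hadj
    fin_cases i <;> simp <;> grind
  · intro i j hij x hx y hy
    have h12 := fun x hx y hy => hhole x hx y hy x3 hx3 y1 hy1 y2 hy2 y3 hy3
    have h23 := fun x hx y hy => hhole x1 hx1 x hx y hy y1 hy1 y2 hy2 y3 hy3
    have h13 := fun x hx y hy => hhole x hx x2 hx2 y hy y1 hy1 y2 hy2 y3 hy3
    clear hc hcov hhole hadj
    fin_cases i <;> fin_cases j <;> simp at hij hx hy <;> grind [G.adj_comm]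
  · intro i j hij x hx y hy
    have h12 := fun x hx y hy => hhole x1 hx1 x2 hx2 x3 hx3 x hx y hy y3 hy3
    have h23 := fun x hx y hy => hhole x1 hx1 x2 hx2 x3 hx3 y1 hy1 x hx y hy
    have h13 := fun x hx y hy => hhole x1 hx1 x2 hx2 x3 hx3 x hx y2 hy2 y hy
    clear hc hcov hhole hadj
    fin_cases i <;> fin_cases j <;> simp at hij hx hy <;> grind [G.adj_comm]
  · intro i j hij x hx y hy
    have h11 := fun x hx y hy => (hhole x hx x2 hx2 x3 hx3 y hy y2 hy2 y3 hy3).1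
    have h21 := fun x hx y hy => (hhole x1 hx1 x hx x3 hx3 y hy y2 hy2 y3 hy3).2.1
    have h22 := fun x hx y hy => (hhole x1 hx1 x hx x3 hx3 y1 hy1 y hy y3 hy3).2.2.1
    have h32 := fun x hx y hy => (hhole x1 hx1 x2 hx2 x hx y1 hy1 y hy y3 hy3).2.2.2.1
    have h33 := fun x hx y hy => (hhole x1 hx1 x2 hx2 x hx y1 hy1 y2 hy2 y hy).2.2.2.2.1
    have h13 := fun x hx y hy => (hhole x hx x2 hx2 x3 hx3 y1 hy1 y2 hy2 y hy).2.2.2.2.2.1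
    clear hc hcov hhole hadj hdisj
    fin_cases i <;> fin_cases j <;> simp at hij hx hy <;> grind [G.adj_comm]
  · intro x hx z hz hxz
    rcases hadj x hx z hz hxz with h | h | h | h | h | h
    exacts [⟨0, 2, by decide, h⟩, ⟨1, 2, by decide, h⟩, ⟨1, 0, by decide, h⟩,
      ⟨2, 0, by decide, h⟩, ⟨2, 1, by decide, h⟩, ⟨0, 1, by decide, h⟩]
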